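/- arXiv:1103.5219 — 13 statements merged into one kernel-verified Lean document; each statement's English description precedes it below -/
import Mathlib

section
/- For all positive real numbers a and b, the following chain of inequalities holds among means: H(a,b) ≤ G(a,b) ≤ N₁(a,b) ≤ N₃(a,b) ≤ N₂(a,b) ≤ A(a,b) ≤ S(a,b). -/
theorem le_of_sq_le_sq_aux {u v : ℝ} (h : u ^ 2 ≤ v ^ 2) (hv : 0 ≤ v) : u ≤ v :=
  abs_le_of_sq_le_sq' h hv |>.2


theorem mean_chain_inequalities (a b : ℝ) (ha : 0 < a) (hb : 0 < b) :
    2 * a * b / (a + b) ≤ Real.sqrt (a * b) ∧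
    Real.sqrt (a * b) ≤ ((Real.sqrt a + Real.sqrt b) / 2) ^ 2 ∧
    ((Real.sqrt a + Real.sqrt b) / 2) ^ 2 ≤ (a + Real.sqrt (a * b) + b) / 3 ∧
    (a + Real.sqrt (a * b) + b) / 3 ≤
      ((Real.sqrt a + Real.sqrt b) / 2) * Real.sqrt ((a + b) / 2) ∧
    ((Real.sqrt a + Real.sqrt b) / 2) * Real.sqrt ((a + b) / 2) ≤ (a + b) / 2 ∧
    (a + b) / 2 ≤ Real.sqrt ((a ^ 2 + b ^ 2) / 2) := by
  have hx : 0 < Real.sqrt a := Real.sqrt_pos.mpr ha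
  have hy : 0 < Real.sqrt b := Real.sqrt_pos.mpr hb
  have hw : 0 ≤ Real.sqrt ((a + b) / 2) := Real.sqrt_nonneg _
  have hw2 : Real.sqrt ((a + b) / 2) ^ 2 = (a + b) / 2 := Real.sq_sqrt (by positivity)
  have hxa : Real.sqrt a ^ 2 = a := Real.sq_sqrt ha.le
  have hyb : Real.sqrt b ^ 2 = b := Real.sq_sqrt hb.le
  have hab : Real.sqrt (a * b) = Real.sqrt a * Real.sqrt b := Real.sqrt_mul ha.le b
  have hS : (a + b) / 2 ≤ Real.sqrt ((a ^ 2 + b ^ 2) / 2) :=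
    Real.le_sqrt_of_sq_le (by nlinarith [sq_nonneg (a - b)])
  rw [hab]
  generalize Real.sqrt ((a + b) / 2) = w at *
  generalize Real.sqrt a = x at *
  generalize Real.sqrt b = y at *
  refine ⟨?_, ?_, ?_, ?_, ?_, hS⟩
  · rw [div_le_iff₀ (by positivity), ← hxa, ← hyb]
    nlinarith [mul_nonneg (mul_pos hx hy).le (sq_nonneg (x - y))]
  · nlinarith [sq_nonneg (x - y)]
  · nlinarith [sq_nonneg (x - y)]
  · refine le_of_sq_le_sq_aux ?_ (by positivity)
    rw [mul_pow, hw2, ← hxa, ← hyb]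
    have h1 : 0 ≤ (x ^ 2 + y ^ 2 + 4 * (x * y)) * (x - y) ^ 2 := by positivity
    nlinarith [h1]
  · have h : (x + y) / 2 ≤ w := by
      refine le_of_sq_le_sq_aux ?_ hw
      rw [hw2, ← hxa, ← hyb]
      nlinarith [sq_nonneg (x - y)]
    nlinarith [mul_le_mul_of_nonneg_right h hw]
end

section
/- For all positive real numbers a and b, the following chain of inequalities holds: S(a,b) − A(a,b) ≤ (1/3)(S(a,b) − H(a,b)) ≤ (1/2)(A(a,b) − H(a,b)) ≤ (1/2)(S(a,b) − G(a,b)) ≤ A(a,b) − G(a,b). -/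
theorem mean_difference_chain_1 (a b : ℝ) (ha : 0 < a) (hb : 0 < b) :
    Real.sqrt ((a ^ 2 + b ^ 2) / 2) - (a + b) / 2 ≤
      (1 / 3) * (Real.sqrt ((a ^ 2 + b ^ 2) / 2) - 2 * a * b / (a + b)) ∧
    (1 / 3) * (Real.sqrt ((a ^ 2 + b ^ 2) / 2) - 2 * a * b / (a + b)) ≤
      (1 / 2) * ((a + b) / 2 - 2 * a * b / (a + b)) ∧
    (1 / 2) * ((a + b) / 2 - 2 * a * b / (a + b)) ≤
      (1 / 2) * (Real.sqrt ((a ^ 2 + b ^ 2) / 2) - Real.sqrt (a * b)) ∧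
    (1 / 2) * (Real.sqrt ((a ^ 2 + b ^ 2) / 2) - Real.sqrt (a * b)) ≤
      (a + b) / 2 - Real.sqrt (a * b) := by
  have hS0 := Real.sqrt_nonneg ((a ^ 2 + b ^ 2) / 2)
  have hS2 := Real.sq_sqrt (show 0 ≤ (a ^ 2 + b ^ 2) / 2 by positivity)
  have hG0 := Real.sqrt_nonneg (a * b)
  have hG2 := Real.sq_sqrt (show 0 ≤ a * b by positivity)
  have hH : 2 * a * b / (a + b) = a * b / ((a + b) / 2) := by
    field_simp
  rw [hH]
  generalize Real.sqrt ((a ^ 2 + b ^ 2) / 2) = S at *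
  generalize Real.sqrt (a * b) = G at *
  obtain ⟨A, hA⟩ : ∃ A, A = (a + b) / 2 := ⟨_, rfl⟩
  have hA0 : 0 < A := by rw [hA]; positivity
  have hGA : G ≤ A := by
    nlinarith [sq_nonneg (a - b)]
  have hSG : S ^ 2 = 2 * A ^ 2 - G ^ 2 := by rw [hS2, hG2, hA]; ring
  rw [← hA, ← hG2]
  obtain ⟨t, ht⟩ : ∃ t, t = G / A := ⟨_, rfl⟩
  have hGt : G = t * A := by rw [ht]; field_simp
  have ht0 : 0 ≤ t := by rw [ht]; positivity
  have ht1 : t ≤ 1 := by rw [ht]; exact (div_le_one hA0).2 hGA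
  have hHt : G ^ 2 / A = t ^ 2 * A := by rw [hGt]; field_simp
  rw [hHt]
  have h1 : 2 * S + t ^ 2 * A ≤ 3 * A := by
    have h : 2 * S ≤ (3 - t ^ 2) * A := by
      apply abs_le_of_sq_le_sq' _ _ |>.2
      · have : (2 * S) ^ 2 = 4 * (2 * A ^ 2 - (t * A) ^ 2) := by rw [← hGt, ← hSG]; ring
        rw [this]
        nlinarith [sq_nonneg ((1 - t ^ 2) * A)]
      · have : 0 ≤ 3 - t ^ 2 := by nlinarith
        positivity
    linarith
  have h3 : (1 + t - t ^ 2) * A ≤ S := by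
    apply (abs_le_of_sq_le_sq' _ hS0).2
    rw [hSG, hGt]
    have : 0 ≤ (1 - t) ^ 3 * (1 + t) * A ^ 2 := by
      have : 0 ≤ 1 - t := by linarith
      positivity
    nlinarith
  have h4 : S + G ≤ 2 * A := by
    nlinarith [sq_nonneg (S - G)]
  refine ⟨by linarith, by linarith, by nlinarith, by linarith⟩
end

section
/- For all positive real numbers a and b, the following chain of inequalities holds: (1/8)(A(a,b) − H(a,b)) ≤ N₂(a,b) − N₁(a,b) ≤ (1/3)(N₂(a,b) − G(a,b)) ≤ (1/4)(A(a,b) − G(a,b)) ≤ A(a,b) − N₂(a,b). -/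
theorem mean_difference_chain_2 (a b : ℝ) (ha : 0 < a) (hb : 0 < b) :
    (1 / 8) * ((a + b) / 2 - 2 * a * b / (a + b)) ≤
      ((Real.sqrt a + Real.sqrt b) / 2) * Real.sqrt ((a + b) / 2) -
        ((Real.sqrt a + Real.sqrt b) / 2) ^ 2 ∧
    ((Real.sqrt a + Real.sqrt b) / 2) * Real.sqrt ((a + b) / 2) -
        ((Real.sqrt a + Real.sqrt b) / 2) ^ 2 ≤
      (1 / 3) * (((Real.sqrt a + Real.sqrt b) / 2) * Real.sqrt ((a + b) / 2) -
        Real.sqrt (a * b)) ∧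
    (1 / 3) * (((Real.sqrt a + Real.sqrt b) / 2) * Real.sqrt ((a + b) / 2) -
        Real.sqrt (a * b)) ≤
      (1 / 4) * ((a + b) / 2 - Real.sqrt (a * b)) ∧
    (1 / 4) * ((a + b) / 2 - Real.sqrt (a * b)) ≤
      (a + b) / 2 - ((Real.sqrt a + Real.sqrt b) / 2) * Real.sqrt ((a + b) / 2) := by
  obtain ⟨x, hx, rfl⟩ : ∃ x : ℝ, 0 < x ∧ a = x ^ 2 :=
    ⟨Real.sqrt a, Real.sqrt_pos.2 ha, (Real.sq_sqrt ha.le).symm⟩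
  obtain ⟨y, hy, rfl⟩ : ∃ y : ℝ, 0 < y ∧ b = y ^ 2 :=
    ⟨Real.sqrt b, Real.sqrt_pos.2 hb, (Real.sq_sqrt hb.le).symm⟩
  have hG : Real.sqrt (x ^ 2 * y ^ 2) = x * y := by
    rw [← mul_pow, Real.sqrt_sq (by positivity)]
  rw [hG, Real.sqrt_sq hx.le, Real.sqrt_sq hy.le]
  have hs : 0 < Real.sqrt ((x ^ 2 + y ^ 2) / 2) := Real.sqrt_pos.2 (by positivity)
  have hs2 : Real.sqrt ((x ^ 2 + y ^ 2) / 2) ^ 2 = (x ^ 2 + y ^ 2) / 2 :=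
    Real.sq_sqrt (by positivity)
  generalize Real.sqrt ((x ^ 2 + y ^ 2) / 2) = s at hs hs2 ⊢
  obtain ⟨m, hm⟩ : ∃ m, m = (x + y) / 2 := ⟨_, rfl⟩
  have hm0 : 0 < m := by rw [hm]; positivity
  have hxy : x * y = 2 * m ^ 2 - s ^ 2 := by rw [hs2, hm]; ring
  have hsum : x ^ 2 + y ^ 2 = 2 * s ^ 2 := by rw [hs2]; ring
  have hms : m ≤ s := by
    refine (sq_le_sq₀ hm0.le hs.le).1 ?_
    rw [hs2, hm]
    nlinarith [sq_nonneg (x - y)]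
  have hp : 2 * x ^ 2 * y ^ 2 = 2 * (2 * m ^ 2 - s ^ 2) ^ 2 := by rw [← hxy]; ring
  rw [← hm, hxy, hsum, hp]
  have key := sq_nonneg (s - m)
  refine ⟨?_, by nlinarith, by nlinarith, by nlinarith⟩
  have e : m * s - m ^ 2 - 1 / 8 * (2 * s ^ 2 / 2 - 2 * (2 * m ^ 2 - s ^ 2) ^ 2 / (2 * s ^ 2))
      = m * (s - m) * ((s - m) * (2 * s + m)) / (2 * s ^ 2) := by
    field_simp
    ring
  have h0 : 0 ≤ s - m := sub_nonneg.2 hms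
  have : 0 ≤ m * (s - m) * ((s - m) * (2 * s + m)) / (2 * s ^ 2) := by positivity
  linarith
end

section
/- For all positive real numbers a and b, the following chain of inequalities holds: (1/4)(S(a,b) − A(a,b)) ≤ (1/5)(S(a,b) − N₂(a,b)) ≤ A(a,b) − N₂(a,b). -/
theorem mean_difference_chain_3 (a b : ℝ) (ha : 0 < a) (hb : 0 < b) :
    (1 / 4) * (Real.sqrt ((a ^ 2 + b ^ 2) / 2) - (a + b) / 2) ≤
      (1 / 5) * (Real.sqrt ((a ^ 2 + b ^ 2) / 2) -
        ((Real.sqrt a + Real.sqrt b) / 2) * Real.sqrt ((a + b) / 2)) ∧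
    (1 / 5) * (Real.sqrt ((a ^ 2 + b ^ 2) / 2) -
        ((Real.sqrt a + Real.sqrt b) / 2) * Real.sqrt ((a + b) / 2)) ≤
      (a + b) / 2 - ((Real.sqrt a + Real.sqrt b) / 2) * Real.sqrt ((a + b) / 2) := by
  have hx := Real.sq_sqrt ha.le
  have hy := Real.sq_sqrt hb.le
  have hm := Real.sq_sqrt (show 0 ≤ (a + b) / 2 by positivity)
  have hx0 := Real.sqrt_nonneg a
  have hy0 := Real.sqrt_nonneg b
  have hm0 := Real.sqrt_nonneg ((a + b) / 2)
  set m := Real.sqrt ((a + b) / 2)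
  obtain ⟨p, hp⟩ : ∃ p, p = (Real.sqrt a + Real.sqrt b) / 2 := ⟨_, rfl⟩
  have hp0 : 0 ≤ p := by rw [hp]; positivity
  have hpm : p ≤ m := by
    apply (sq_le_sq₀ hp0 hm0).mp
    rw [hm, hp]; nlinarith [sq_nonneg (Real.sqrt a - Real.sqrt b)]
  have hg : Real.sqrt a * Real.sqrt b = 2 * p ^ 2 - m ^ 2 := by
    rw [hp]; nlinarith
  have hab : a * b = (2 * p ^ 2 - m ^ 2) ^ 2 := by
    rw [← hg, mul_pow, hx, hy]
  have hs : a ^ 2 + b ^ 2 = 4 * m ^ 4 - 2 * (2 * p ^ 2 - m ^ 2) ^ 2 := by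
    have h4 : m ^ 4 = ((a + b) / 2) ^ 2 := by rw [← hm]; ring
    rw [← hab, h4]; ring
  have key : Real.sqrt ((a ^ 2 + b ^ 2) / 2) ≤ 5 * m ^ 2 - 4 * (p * m) := by
    apply Real.sqrt_le_iff.mpr
    constructor
    · nlinarith [mul_le_mul_of_nonneg_right hpm hm0, sq_nonneg m]
    · rw [hs]
      have h : 0 ≤ 4 * (p - m) ^ 2 * (p ^ 2 + 2 * p * m + 6 * m ^ 2) := by positivity
      nlinarith [h]
  rw [← hp]
  constructor <;> linarith
end

section
/- For all positive real numbers a and b, the following chain of inequalities holds: (1/2)(S(a,b) − H(a,b)) ≤ S(a,b) − N₁(a,b) ≤ (3/4)(S(a,b) − G(a,b)). -/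
theorem mean_difference_chain_4 (a b : ℝ) (ha : 0 < a) (hb : 0 < b) :
    (1 / 2) * (Real.sqrt ((a ^ 2 + b ^ 2) / 2) - 2 * a * b / (a + b)) ≤
      Real.sqrt ((a ^ 2 + b ^ 2) / 2) - ((Real.sqrt a + Real.sqrt b) / 2) ^ 2 ∧
    Real.sqrt ((a ^ 2 + b ^ 2) / 2) - ((Real.sqrt a + Real.sqrt b) / 2) ^ 2 ≤
      (3 / 4) * (Real.sqrt ((a ^ 2 + b ^ 2) / 2) - Real.sqrt (a * b)) := by
  have hG : Real.sqrt (a * b) = Real.sqrt a * Real.sqrt b := Real.sqrt_mul ha.le b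
  have hx := Real.sq_sqrt ha.le
  have hy := Real.sq_sqrt hb.le
  have hG2 : Real.sqrt (a * b) ^ 2 = a * b := Real.sq_sqrt (by positivity)
  have hG0 : 0 < Real.sqrt (a * b) := by positivity
  have hN : ((Real.sqrt a + Real.sqrt b) / 2) ^ 2 = ((a + b) / 2 + Real.sqrt (a * b)) / 2 := by
    rw [hG]; linear_combination (hx + hy) / 4
  rw [hN]
  set g := Real.sqrt (a * b) with hg
  have hA : 0 < (a + b) / 2 := by positivity
  have hH : 2 * a * b / (a + b) = g ^ 2 / ((a + b) / 2) := by
    rw [hG2]; field_simp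
  have hS : (a ^ 2 + b ^ 2) / 2 = 2 * ((a + b) / 2) ^ 2 - g ^ 2 := by rw [hG2]; ring
  have hgA : g ≤ (a + b) / 2 := by
    apply Real.sqrt_le_iff.2 ⟨hA.le, by nlinarith [sq_nonneg (a - b)]⟩
  rw [hH, hS]
  generalize (a + b) / 2 = A at *
  constructor
  · have key : A + g - g ^ 2 / A ≤ Real.sqrt (2 * A ^ 2 - g ^ 2) := by
      apply Real.le_sqrt_of_sq_le
      have h : 2 * A ^ 2 - g ^ 2 - (A + g - g ^ 2 / A) ^ 2 = (A - g) ^ 3 * (A + g) / A ^ 2 := by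
        field_simp
        ring
      have : 0 ≤ (A - g) ^ 3 * (A + g) / A ^ 2 := by
        have := sub_nonneg.2 hgA
        positivity
      linarith
    linarith
  · have key : Real.sqrt (2 * A ^ 2 - g ^ 2) ≤ 2 * A - g :=
      Real.sqrt_le_iff.2 ⟨by linarith, by nlinarith [sq_nonneg (A - g)]⟩
    linarith
end

section
/- For all positive real numbers a and b, the following chain of inequalities holds: S(a,b) − A(a,b) ≤ (3/4)(S(a,b) − N₃(a,b)) ≤ (2/3)(S(a,b) − N₁(a,b)). -/
theorem mean_difference_chain_5 (a b : ℝ) (ha : 0 < a) (hb : 0 < b) :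
    Real.sqrt ((a ^ 2 + b ^ 2) / 2) - (a + b) / 2 ≤
      (3 / 4) * (Real.sqrt ((a ^ 2 + b ^ 2) / 2) - (a + Real.sqrt (a * b) + b) / 3) ∧
    (3 / 4) * (Real.sqrt ((a ^ 2 + b ^ 2) / 2) - (a + Real.sqrt (a * b) + b) / 3) ≤
      (2 / 3) * (Real.sqrt ((a ^ 2 + b ^ 2) / 2) - ((Real.sqrt a + Real.sqrt b) / 2) ^ 2) := by
  have hg : Real.sqrt (a * b) = Real.sqrt a * Real.sqrt b := Real.sqrt_mul ha.le b
  have h1 := Real.sq_sqrt ha.le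
  have h2 := Real.sq_sqrt hb.le
  have hg2 : Real.sqrt (a * b) ^ 2 = a * b := Real.sq_sqrt (mul_pos ha hb).le
  have hN : ((Real.sqrt a + Real.sqrt b) / 2) ^ 2 = (a + b + 2 * Real.sqrt (a * b)) / 4 := by
    rw [hg]; linear_combination (h1 + h2) / 4
  have key : Real.sqrt ((a ^ 2 + b ^ 2) / 2) ≤ a + b - Real.sqrt (a * b) := by
    apply Real.sqrt_le_iff.mpr
    constructor
    · have : Real.sqrt (a * b) ≤ a + b := by
        apply Real.sqrt_le_iff.mpr
        constructor
        · positivity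
        · nlinarith [mul_pos ha hb]
      linarith
    · nlinarith [sq_nonneg (a + b - 2 * Real.sqrt (a * b))]
  rw [hN]
  constructor <;> linarith
end

section
/- The function f_{SN₂}(x) = √((x²+1)/2) − ((√x+1)/2)·√((x+1)/2) is convex on the interval (0,∞). -/
theorem convexOn_f_SN2 :
    ConvexOn ℝ (Set.Ioi (0 : ℝ))
      (fun x => Real.sqrt ((x ^ 2 + 1) / 2) -
        ((Real.sqrt x + 1) / 2) * Real.sqrt ((x + 1) / 2)) := by
  refine ⟨convex_Ioi 0, ?_⟩
  intro x hx y hy a b ha hb hab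
  have hx0 : 0 < x := hx
  have hy0 : 0 < y := hy
  simp only [smul_eq_mul]
  have hz : 0 ≤ a * x + b * y := by positivity
  have hb1 : b = 1 - a := by linarith
  have hab0 : 0 ≤ a * b := by positivity
  -- convexity of the root-square mean
  have h1 : Real.sqrt (((a * x + b * y) ^ 2 + 1) / 2) ≤
      a * Real.sqrt ((x ^ 2 + 1) / 2) + b * Real.sqrt ((y ^ 2 + 1) / 2) := by
    have hp := Real.sq_sqrt (show 0 ≤ (x ^ 2 + 1) / 2 by positivity)
    have hq := Real.sq_sqrt (show 0 ≤ (y ^ 2 + 1) / 2 by positivity)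
    have hp0 := Real.sqrt_nonneg ((x ^ 2 + 1) / 2)
    have hq0 := Real.sqrt_nonneg ((y ^ 2 + 1) / 2)
    set p := Real.sqrt ((x ^ 2 + 1) / 2)
    set q := Real.sqrt ((y ^ 2 + 1) / 2)
    have hpq : (x * y + 1) / 2 ≤ p * q := by
      refine le_of_abs_le (abs_le_of_sq_le_sq ?_ (by positivity))
      rw [mul_pow, hp, hq]
      nlinarith [sq_nonneg (x - y)]
    apply Real.sqrt_le_iff.mpr ⟨by positivity, ?_⟩
    have e : (a * p + b * q) ^ 2 - ((a * x + b * y) ^ 2 + 1) / 2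
        = 2 * (a * b) * (p * q - (x * y + 1) / 2) := by
      have : (a * p + b * q) ^ 2 = a ^ 2 * p ^ 2 + b ^ 2 * q ^ 2 + 2 * (a * b) * (p * q) := by ring
      rw [this, hp, hq, hb1]; ring
    have := mul_nonneg (mul_nonneg zero_le_two hab0) (sub_nonneg.mpr hpq)
    linarith
  -- concavity of `√(x (x+1) / 2)`
  have h2 : a * Real.sqrt (x * ((x + 1) / 2)) + b * Real.sqrt (y * ((y + 1) / 2)) ≤
      Real.sqrt ((a * x + b * y) * ((a * x + b * y + 1) / 2)) := by
    have hp := Real.sq_sqrt (show 0 ≤ x * ((x + 1) / 2) by positivity)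
    have hq := Real.sq_sqrt (show 0 ≤ y * ((y + 1) / 2) by positivity)
    set p := Real.sqrt (x * ((x + 1) / 2))
    set q := Real.sqrt (y * ((y + 1) / 2))
    have hpq : p * q ≤ (2 * (x * y) + x + y) / 4 := by
      refine le_of_abs_le (abs_le_of_sq_le_sq ?_ (by positivity))
      rw [mul_pow, hp, hq]
      nlinarith [sq_nonneg (x - y)]
    apply Real.le_sqrt_of_sq_le
    have e : (a * x + b * y) * ((a * x + b * y + 1) / 2) - (a * p + b * q) ^ 2
        = 2 * (a * b) * ((2 * (x * y) + x + y) / 4 - p * q) := by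
      have : (a * p + b * q) ^ 2 = a ^ 2 * p ^ 2 + b ^ 2 * q ^ 2 + 2 * (a * b) * (p * q) := by ring
      rw [this, hp, hq, hb1]; ring
    have := mul_nonneg (mul_nonneg zero_le_two hab0) (sub_nonneg.mpr hpq)
    linarith
  -- concavity of `√((x+1) / 2)`
  have h3 : a * Real.sqrt ((x + 1) / 2) + b * Real.sqrt ((y + 1) / 2) ≤
      Real.sqrt ((a * x + b * y + 1) / 2) := by
    have h := Real.strictConcaveOn_sqrt.concaveOn.2
      (show (x + 1) / 2 ∈ Set.Ici (0 : ℝ) from Set.mem_Ici.mpr (by positivity))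
      (show (y + 1) / 2 ∈ Set.Ici (0 : ℝ) from Set.mem_Ici.mpr (by positivity)) ha hb hab
    simp only [smul_eq_mul] at h
    have e : a * ((x + 1) / 2) + b * ((y + 1) / 2) = (a * x + b * y + 1) / 2 := by
      rw [hb1]; ring
    rwa [e] at h
  rw [Real.sqrt_mul hx0.le, Real.sqrt_mul hy0.le, Real.sqrt_mul hz] at h2
  linarith
end

section
/- The function f_{SN₁}(x) = √((x²+1)/2) − ((√x+1)/2)² is convex on the interval (0,∞). -/
theorem convexOn_f_SN1 :
    ConvexOn ℝ (Set.Ioi (0 : ℝ))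
      (fun x => Real.sqrt ((x ^ 2 + 1) / 2) - ((Real.sqrt x + 1) / 2) ^ 2) := by
  refine ⟨convex_Ioi 0, ?_⟩
  intro x hx y hy a b ha hb hab
  have hx0 : (0 : ℝ) < x := hx
  have hy0 : (0 : ℝ) < y := hy
  have hc := Real.strictConcaveOn_sqrt.concaveOn.2 (Set.mem_Ici.2 hx0.le)
    (Set.mem_Ici.2 hy0.le) ha hb hab
  simp only [smul_eq_mul] at hc ⊢
  have hz : 0 ≤ a * x + b * y := by positivity
  have sx := Real.sq_sqrt hx0.le
  have sy := Real.sq_sqrt hy0.le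
  have sz := Real.sq_sqrt hz
  have hS : Real.sqrt (((a * x + b * y) ^ 2 + 1) / 2)
      ≤ a * Real.sqrt ((x ^ 2 + 1) / 2) + b * Real.sqrt ((y ^ 2 + 1) / 2) := by
    have hP : (x * y + 1) / 2 ≤ Real.sqrt ((x ^ 2 + 1) / 2) * Real.sqrt ((y ^ 2 + 1) / 2) := by
      rw [← Real.sqrt_mul (by positivity)]
      apply Real.le_sqrt_of_sq_le
      nlinarith [sq_nonneg (x - y)]
    have p2 := Real.sq_sqrt (show 0 ≤ (x ^ 2 + 1) / 2 by positivity)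
    have q2 := Real.sq_sqrt (show 0 ≤ (y ^ 2 + 1) / 2 by positivity)
    apply Real.sqrt_le_iff.2 ⟨by positivity, ?_⟩
    have h := mul_le_mul_of_nonneg_left hP (mul_nonneg ha hb)
    have e : (a * Real.sqrt ((x ^ 2 + 1) / 2) + b * Real.sqrt ((y ^ 2 + 1) / 2)) ^ 2
        = a ^ 2 * ((x ^ 2 + 1) / 2) + b ^ 2 * ((y ^ 2 + 1) / 2)
          + 2 * (a * b * (Real.sqrt ((x ^ 2 + 1) / 2) * Real.sqrt ((y ^ 2 + 1) / 2))) := by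
      rw [← p2, ← q2]
      simp only [Real.sqrt_sq (Real.sqrt_nonneg _)]
      ring
    rw [e]
    have h1 : (a + b) ^ 2 = 1 := by rw [hab]; norm_num
    nlinarith
  have key : ∀ t : ℝ, 0 ≤ t → ((Real.sqrt t + 1) / 2) ^ 2 = t / 4 + Real.sqrt t / 2 + 1 / 4 := by
    intro t ht
    linear_combination (1 / 4) * Real.sq_sqrt ht
  rw [key _ hx0.le, key _ hy0.le, key _ hz]
  have : b = 1 - a := by linarith
  nlinarith
end

section
/- The function f_{SH}(x) = √((x²+1)/2) − 2x/(x+1) is convex on the interval (0,∞). -/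
theorem convexOn_f_SH :
    ConvexOn ℝ (Set.Ioi (0 : ℝ))
      (fun x => Real.sqrt ((x ^ 2 + 1) / 2) - 2 * x / (x + 1)) := by
  refine ⟨convex_Ioi 0, ?_⟩
  intro x hx y hy a b ha hb hab
  simp only [Set.mem_Ioi, smul_eq_mul] at *
  have h1 : Real.sqrt (((a * x + b * y) ^ 2 + 1) / 2) ≤
      a * Real.sqrt ((x ^ 2 + 1) / 2) + b * Real.sqrt ((y ^ 2 + 1) / 2) := by
    have hs := Real.sq_sqrt (show 0 ≤ (x ^ 2 + 1) / 2 by positivity)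
    have ht := Real.sq_sqrt (show 0 ≤ (y ^ 2 + 1) / 2 by positivity)
    have hs0 := Real.sqrt_nonneg ((x ^ 2 + 1) / 2)
    have ht0 := Real.sqrt_nonneg ((y ^ 2 + 1) / 2)
    generalize Real.sqrt ((x ^ 2 + 1) / 2) = s at *
    generalize Real.sqrt ((y ^ 2 + 1) / 2) = t at *
    have hst : (x * y + 1) / 2 ≤ s * t := by
      refine (sq_le_sq₀ (by positivity) (by positivity)).1 ?_
      rw [mul_pow, hs, ht]
      nlinarith [sq_nonneg (x - y)]
    apply Real.sqrt_le_iff.2 ⟨by positivity, ?_⟩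
    have e : (a * s + b * t) ^ 2 - ((a * x + b * y) ^ 2 + (a + b) ^ 2) / 2
        = 2 * (a * b) * (s * t - (x * y + 1) / 2) := by
      linear_combination a ^ 2 * hs + b ^ 2 * ht
    rw [hab] at e
    have := mul_nonneg (mul_nonneg (zero_le_two (α := ℝ)) (mul_nonneg ha hb)) (sub_nonneg.2 hst)
    linarith
  have h2 : a * (2 * x / (x + 1)) + b * (2 * y / (y + 1)) ≤
      2 * (a * x + b * y) / (a * x + b * y + 1) := by
    have hb' : b = 1 - a := by linarith
    have hp : 0 < a * x + b * y + 1 := by positivity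
    have e : 2 * (a * x + b * y) / (a * x + b * y + 1) -
        (a * (2 * x / (x + 1)) + b * (2 * y / (y + 1))) =
        2 * a * b * (x - y) ^ 2 / ((x + 1) * (y + 1) * (a * x + b * y + 1)) := by
      have := hp.ne'
      have : x + 1 ≠ 0 := by positivity
      have : y + 1 ≠ 0 := by positivity
      subst hb'
      field_simp
      ring
    have : 0 ≤ 2 * a * b * (x - y) ^ 2 / ((x + 1) * (y + 1) * (a * x + b * y + 1)) := by
      positivity
    linarith
  linarith
end

section
/- The function f_{AN₂}(x) = (x+1)/2 − ((√x+1)/2)·√((x+1)/2) is convex on the interval (0,∞). -/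
theorem convexOn_f_AN2 :
    ConvexOn ℝ (Set.Ioi (0 : ℝ))
      (fun x => (x + 1) / 2 - ((Real.sqrt x + 1) / 2) * Real.sqrt ((x + 1) / 2)) := by
  refine ⟨convex_Ioi 0, ?_⟩
  intro x hx y hy a b ha hb hab
  simp only [Set.mem_Ioi] at hx hy
  simp only [smul_eq_mul]
  have hz : 0 ≤ a * x + b * y := by positivity
  have hu := Real.sq_sqrt hx.le
  have hv := Real.sq_sqrt hy.le
  have hw := Real.sq_sqrt hz
  have hU := Real.sq_sqrt (show 0 ≤ (x + 1) / 2 by positivity)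
  have hV := Real.sq_sqrt (show 0 ≤ (y + 1) / 2 by positivity)
  have hW := Real.sq_sqrt (show 0 ≤ (a * x + b * y + 1) / 2 by positivity)
  have hw0 := Real.sqrt_nonneg (a * x + b * y)
  have hW0 := Real.sqrt_nonneg ((a * x + b * y + 1) / 2)
  generalize Real.sqrt x = u at *
  generalize Real.sqrt y = v at *
  generalize Real.sqrt (a * x + b * y) = w at *
  generalize Real.sqrt ((x + 1) / 2) = U at *
  generalize Real.sqrt ((y + 1) / 2) = V at *
  generalize Real.sqrt ((a * x + b * y + 1) / 2) = W at *
  have e1 : w ^ 2 = a * u ^ 2 + b * v ^ 2 := by rw [hw, hu, hv]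
  have e2 : W ^ 2 = a * U ^ 2 + b * V ^ 2 := by
    rw [hW, hU, hV]; linear_combination (-1 / 2) * hab
  have h1 : a * (u * U) + b * (v * V) ≤ w * W := by
    refine abs_le_of_sq_le_sq' ?_ (mul_nonneg hw0 hW0) |>.2
    have : 0 ≤ a * b * (u * V - v * U) ^ 2 := by positivity
    rw [mul_pow, e1, e2]
    linarith
  have h2 : a * U + b * V ≤ W := by
    refine abs_le_of_sq_le_sq' ?_ hW0 |>.2
    have : 0 ≤ a * b * (U - V) ^ 2 := by positivity
    have hb' : b = 1 - a := by linarith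
    rw [e2]
    subst hb'
    linarith
  linarith
end

section
/- The function f_{N₂N₁}(x) = ((√x+1)/2)·√((x+1)/2) − ((√x+1)/2)² is convex on the interval (0,∞). -/
theorem convexOn_f_N2N1 :
    ConvexOn ℝ (Set.Ioi (0 : ℝ))
      (fun x => ((Real.sqrt x + 1) / 2) * Real.sqrt ((x + 1) / 2) -
        ((Real.sqrt x + 1) / 2) ^ 2) := by
  have hs : ∀ x : ℝ, 0 < x → HasDerivAt (fun y => Real.sqrt y) (1 / (2 * Real.sqrt x)) x :=
    fun x hx => Real.hasDerivAt_sqrt hx.ne'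
  have hw : ∀ x : ℝ, 0 < x → HasDerivAt (fun y => Real.sqrt ((y + 1) / 2))
      ((1 / 2) / (2 * Real.sqrt ((x + 1) / 2))) x := fun x hx =>
    (((hasDerivAt_id x).add_const (1 : ℝ)).div_const 2).sqrt (by simp only [id]; positivity)
  have h1 : ∀ x : ℝ, 0 < x → HasDerivAt (fun x => ((Real.sqrt x + 1) / 2) *
      Real.sqrt ((x + 1) / 2) - ((Real.sqrt x + 1) / 2) ^ 2)
      (Real.sqrt ((x + 1) / 2) / (4 * Real.sqrt x) +
        (Real.sqrt x + 1) / (8 * Real.sqrt ((x + 1) / 2)) - 1 / 4 - 1 / (4 * Real.sqrt x)) x := by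
    intro x hx
    have hsp := Real.sqrt_pos.2 hx
    have hwp := Real.sqrt_pos.2 (show 0 < (x + 1) / 2 by positivity)
    have ha := ((hs x hx).add_const (1 : ℝ)).div_const 2
    refine ((ha.mul (hw x hx)).sub (ha.pow 2)).congr_deriv ?_
    generalize Real.sqrt x = s at *
    generalize Real.sqrt ((x + 1) / 2) = w at *
    field_simp
    ring
  have h2 : ∀ x : ℝ, 0 < x → HasDerivAt (fun x => Real.sqrt ((x + 1) / 2) / (4 * Real.sqrt x) +
        (Real.sqrt x + 1) / (8 * Real.sqrt ((x + 1) / 2)) - 1 / 4 - 1 / (4 * Real.sqrt x))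
      ((4 * Real.sqrt ((x + 1) / 2) ^ 3 - 1 - Real.sqrt x ^ 3) /
        (32 * Real.sqrt x ^ 3 * Real.sqrt ((x + 1) / 2) ^ 3)) x := by
    intro x hx
    have hsp := Real.sqrt_pos.2 hx
    have hwp := Real.sqrt_pos.2 (show 0 < (x + 1) / 2 by positivity)
    have hss := Real.sq_sqrt hx.le
    have hww := Real.sq_sqrt (show 0 ≤ (x + 1) / 2 by positivity)
    have ha := (hs x hx).const_mul 4
    have hb := (hw x hx).const_mul 8
    refine HasDerivAt.congr_deriv ((((((hw x hx).div ha (by positivity)).add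
      (((hs x hx).add_const (1 : ℝ)).div hb (by positivity))).sub_const (1 / 4))).sub
      ((hasDerivAt_const x (1 : ℝ)).div ha (by positivity))) ?_
    generalize Real.sqrt x = s at *
    generalize Real.sqrt ((x + 1) / 2) = w at *
    have hk : w ^ 2 = (s ^ 2 + 1) / 2 := by rw [hww, hss]
    have e : 4 * w ^ 3 - 1 - s ^ 3 = 4 * s ^ 2 * w ^ 2 - 4 * w ^ 4 - (s + 1) * s ^ 3 + 4 * w ^ 3 := by
      have : w ^ 4 = ((s ^ 2 + 1) / 2) ^ 2 := by rw [← hk]; ring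
      rw [this, hk]; ring
    rw [e]
    field_simp
    ring
  refine convexOn_of_hasDerivWithinAt2_nonneg (convex_Ioi 0)
    (fun x hx => (h1 x hx).continuousAt.continuousWithinAt)
    (fun x hx => (h1 x (by simpa using hx)).hasDerivWithinAt)
    (fun x hx => (h2 x (by simpa using hx)).hasDerivWithinAt) ?_
  intro x hx
  have hx : 0 < x := by simpa using hx
  have hsp := Real.sqrt_pos.2 hx
  have hwp := Real.sqrt_pos.2 (show 0 < (x + 1) / 2 by positivity)
  have hss := Real.sq_sqrt hx.le
  have hww := Real.sq_sqrt (show 0 ≤ (x + 1) / 2 by positivity)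
  generalize Real.sqrt x = s at *
  generalize Real.sqrt ((x + 1) / 2) = w at *
  have hk : w ^ 2 = (s ^ 2 + 1) / 2 := by rw [hww, hss]
  apply div_nonneg _ (by positivity)
  have : 1 + s ^ 3 ≤ 4 * w ^ 3 := by
    refine (sq_le_sq₀ (by positivity) (by positivity)).1 ?_
    have : (4 * w ^ 3) ^ 2 = 16 * ((s ^ 2 + 1) / 2) ^ 3 := by rw [← hk]; ring
    rw [this]
    nlinarith [sq_nonneg (s ^ 3 - 1), sq_nonneg s, sq_nonneg (s ^ 2)]
  linarith
end

section
/- The function f_{N₂G}(x) = ((√x+1)/2)·√((x+1)/2) − √x is convex on the interval (0,∞). -/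
theorem convexOn_f_N2G :
    ConvexOn ℝ (Set.Ioi (0 : ℝ))
      (fun x => ((Real.sqrt x + 1) / 2) * Real.sqrt ((x + 1) / 2) - Real.sqrt x) := by
  have hs : ∀ x : ℝ, 0 < x → HasDerivAt (fun y => Real.sqrt y) (1 / (2 * Real.sqrt x)) x :=
    fun x hx => Real.hasDerivAt_sqrt hx.ne'
  have ht : ∀ x : ℝ, 0 < x →
      HasDerivAt (fun y => Real.sqrt ((y + 1) / 2)) ((1 / 2) / (2 * Real.sqrt ((x + 1) / 2))) x := by
    intro x hx
    have h : HasDerivAt (fun y : ℝ => (y + 1) / 2) (1 / 2) x :=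
      ((hasDerivAt_id x).add_const 1).div_const 2
    exact h.sqrt (by positivity)
  have h1 : ∀ x : ℝ, 0 < x → HasDerivAt
      (fun x => ((Real.sqrt x + 1) / 2) * Real.sqrt ((x + 1) / 2) - Real.sqrt x)
      (Real.sqrt ((x + 1) / 2) / (4 * Real.sqrt x)
        + (Real.sqrt x + 1) / (8 * Real.sqrt ((x + 1) / 2)) - 1 / (2 * Real.sqrt x)) x := by
    intro x hx
    refine (((((hs x hx).add_const 1).div_const 2).mul (ht x hx)).sub (hs x hx)).congr_deriv ?_
    have a : 0 < Real.sqrt x := Real.sqrt_pos.2 hx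
    have b : 0 < Real.sqrt ((x + 1) / 2) := Real.sqrt_pos.2 (by positivity)
    field_simp
    ring
  have h2 : ∀ x : ℝ, 0 < x → HasDerivAt
      (fun x => Real.sqrt ((x + 1) / 2) / (4 * Real.sqrt x)
        + (Real.sqrt x + 1) / (8 * Real.sqrt ((x + 1) / 2)) - 1 / (2 * Real.sqrt x))
      ((8 * Real.sqrt ((x + 1) / 2) ^ 3 - 1 - Real.sqrt x ^ 3)
        / (32 * Real.sqrt x ^ 3 * Real.sqrt ((x + 1) / 2) ^ 3)) x := by
    intro x hx
    have a : 0 < Real.sqrt x := Real.sqrt_pos.2 hx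
    have b : 0 < Real.sqrt ((x + 1) / 2) := Real.sqrt_pos.2 (by positivity)
    have e : 2 * Real.sqrt ((x + 1) / 2) ^ 2 = Real.sqrt x ^ 2 + 1 := by
      rw [Real.sq_sqrt (by positivity), Real.sq_sqrt hx.le]; ring
    have ha := hs x hx
    have hb := ht x hx
    refine (((hb.div (ha.const_mul 4) (by positivity)).add
      ((ha.add_const 1).div (hb.const_mul 8) (by positivity))).sub
      ((hasDerivAt_const x (1 : ℝ)).div (ha.const_mul 2) (by positivity))).congr_deriv ?_
    generalize Real.sqrt ((x + 1) / 2) = t at *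
    generalize Real.sqrt x = s at *
    have key : (1 / (16 * s * t) - t / (8 * s ^ 3)) + (1 / (16 * s * t) - (s + 1) / (32 * t ^ 3))
        + 1 / (4 * s ^ 3) = (8 * t ^ 3 - 1 - s ^ 3) / (32 * s ^ 3 * t ^ 3) := by
      have e' : 4 * s ^ 2 * t ^ 2 - 4 * t ^ 4 - (s + 1) * s ^ 3 + 8 * t ^ 3
          = 8 * t ^ 3 - 1 - s ^ 3 := by
        linear_combination (2 * s ^ 2 - 2 * t ^ 2 - s ^ 2 - 1) * e
      rw [← e']
      field_simp
      ring
    rw [← key]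
    field_simp
    ring
  refine convexOn_of_hasDerivWithinAt2_nonneg (convex_Ioi 0)
    (fun x hx => (h1 x hx).continuousAt.continuousWithinAt)
    (fun x hx => (h1 x (interior_subset hx)).hasDerivWithinAt)
    (fun x hx => (h2 x (interior_subset hx)).hasDerivWithinAt) ?_
  intro x hx
  have hx : 0 < x := interior_subset hx
  have a : 0 < Real.sqrt x := Real.sqrt_pos.2 hx
  have b : 0 < Real.sqrt ((x + 1) / 2) := Real.sqrt_pos.2 (by positivity)
  have e : 2 * Real.sqrt ((x + 1) / 2) ^ 2 = Real.sqrt x ^ 2 + 1 := by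
    rw [Real.sq_sqrt (by positivity), Real.sq_sqrt hx.le]; ring
  generalize Real.sqrt ((x + 1) / 2) = t at *
  generalize Real.sqrt x = s at *
  have h : s + 1 ≤ 2 * t := abs_le_of_sq_le_sq' (by nlinarith [sq_nonneg (s - 1)]) (by positivity) |>.2
  have h3 : (s + 1) ^ 3 ≤ (2 * t) ^ 3 := pow_le_pow_left₀ (by positivity) h 3
  apply div_nonneg _ (by positivity)
  nlinarith [mul_pos a a]
end

section
/- If f : (0,∞) → ℝ is convex, then the function f*(u) = u·f((1−u)/u) is convex on the open interval (0,1); moreover, if f is strictly convex then f* is strictly convex on (0,1). -/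
theorem convexOn_star_of_convexOn (f : ℝ → ℝ) :
    (ConvexOn ℝ (Set.Ioi (0 : ℝ)) f →
      ConvexOn ℝ (Set.Ioo (0 : ℝ) 1) (fun u => u * f ((1 - u) / u))) ∧
    (StrictConvexOn ℝ (Set.Ioi (0 : ℝ)) f →
      StrictConvexOn ℝ (Set.Ioo (0 : ℝ) 1) (fun u => u * f ((1 - u) / u))) := by
  have key : ∀ x y a b : ℝ, 0 < x → 0 < y → 0 < a → 0 < b → a + b = 1 →
      (a * x / (a * x + b * y)) * ((1 - x) / x) + (b * y / (a * x + b * y)) * ((1 - y) / y)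
        = (1 - (a * x + b * y)) / (a * x + b * y) := by
    intro x y a b hx hy ha hb hab
    have hw : 0 < a * x + b * y := by positivity
    have h1 : a * x / (a * x + b * y) * ((1 - x) / x) = a * (1 - x) / (a * x + b * y) := by
      field_simp
    have h2 : b * y / (a * x + b * y) * ((1 - y) / y) = b * (1 - y) / (a * x + b * y) := by
      field_simp
    rw [h1, h2, ← add_div]
    congr 1
    linear_combination hab
  have key2 : ∀ x y a b p q : ℝ, 0 < x → 0 < y → 0 < a → 0 < b →
      (a * x + b * y) * ((a * x / (a * x + b * y)) * p + (b * y / (a * x + b * y)) * q)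
        = a * (x * p) + b * (y * q) := by
    intro x y a b p q hx hy ha hb
    have hw : 0 < a * x + b * y := by positivity
    field_simp
  have key3 : ∀ x y a b : ℝ, 0 < x → 0 < y → 0 < a → 0 < b →
      a * x / (a * x + b * y) + b * y / (a * x + b * y) = 1 := by
    intro x y a b hx hy ha hb
    have hw : 0 < a * x + b * y := by positivity
    rw [← add_div, div_self hw.ne']
  constructor
  · intro hf
    rw [convexOn_iff_forall_pos]
    refine ⟨convex_Ioo 0 1, ?_⟩
    rintro x ⟨hx, hx1⟩ y ⟨hy, hy1⟩ a b ha hb hab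
    have hw : 0 < a * x + b * y := by positivity
    have h := hf.2
      (show (1 - x) / x ∈ Set.Ioi (0 : ℝ) from div_pos (by linarith) hx)
      (show (1 - y) / y ∈ Set.Ioi (0 : ℝ) from div_pos (by linarith) hy)
      (show 0 ≤ a * x / (a * x + b * y) by positivity)
      (show 0 ≤ b * y / (a * x + b * y) by positivity) (key3 x y a b hx hy ha hb)
    simp only [smul_eq_mul] at h ⊢
    rw [key x y a b hx hy ha hb hab] at h
    rw [← key2 x y a b _ _ hx hy ha hb]
    exact mul_le_mul_of_nonneg_left h hw.le
  · intro hf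
    refine ⟨convex_Ioo 0 1, ?_⟩
    rintro x ⟨hx, hx1⟩ y ⟨hy, hy1⟩ hxy a b ha hb hab
    have hw : 0 < a * x + b * y := by positivity
    have hne : (1 - x) / x ≠ (1 - y) / y := by
      intro h
      rw [div_eq_div_iff hx.ne' hy.ne'] at h
      apply hxy
      linarith
    have h := hf.2
      (show (1 - x) / x ∈ Set.Ioi (0 : ℝ) from div_pos (by linarith) hx)
      (show (1 - y) / y ∈ Set.Ioi (0 : ℝ) from div_pos (by linarith) hy) hne
      (show 0 < a * x / (a * x + b * y) by positivity)
      (show 0 < b * y / (a * x + b * y) by positivity) (key3 x y a b hx hy ha hb)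
    simp only [smul_eq_mul] at h ⊢
    rw [key x y a b hx hy ha hb hab] at h
    rw [← key2 x y a b _ _ hx hy ha hb]
    exact mul_lt_mul_of_pos_left h hw
end
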